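/- Let F be a finite field and M a finite-dimensional F-vector space equipped with a nondegenerate alternating bilinear form B (B(x,x) = 0 for all x, and B(x,y) = 0 for all y implies x = 0). Then the symplectic quandle M∖{0} is connected: for any nonzero x, y ∈ M there exist finitely many elements z₁, …, zₙ ∈ M and signs ε₁, …, εₙ ∈ {+1, −1} such that (⋯((x ▷^{ε₁} z₁) ▷^{ε₂} z₂) ⋯ ) ▷^{εₙ} zₙ = y, where x ▷ z = x + B(x,z)·z and x ▷⁻¹ z = x − B(x,z)·z. -/

import Mathlib

/-- The symplectic quandle operation `x ▷ y = x + B(x,y) • y`. -/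
def symOp {F : Type*} [Field F] {M : Type*} [AddCommGroup M] [Module F M]
    (B : M →ₗ[F] M →ₗ[F] F) (x y : M) : M :=
  x + B x y • y

/-- The inverse operation `x ▷⁻¹ y = x - B(x,y) • y`. -/
def symOpInv {F : Type*} [Field F] {M : Type*} [AddCommGroup M] [Module F M]
    (B : M →ₗ[F] M →ₗ[F] F) (x y : M) : M :=
  x - B x y • y

/-- Apply a finite sequence of `▷^{ε}` operations (sign `true` for `▷`,
sign `false` for `▷⁻¹`) with the given elements, starting from `x`. -/
def symOpSeq {F : Type*} [Field F] {M : Type*} [AddCommGroup M] [Module F M]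
    (B : M →ₗ[F] M →ₗ[F] F) (x : M) : List (M × Bool) → M
  | [] => x
  | (z, ε) :: t => symOpSeq B (if ε then symOp B x z else symOpInv B x z) t

theorem symOpSeq_append {F : Type*} [Field F] {M : Type*} [AddCommGroup M] [Module F M]
    (B : M →ₗ[F] M →ₗ[F] F) (x : M) (l₁ l₂ : List (M × Bool)) :
    symOpSeq B x (l₁ ++ l₂) = symOpSeq B (symOpSeq B x l₁) l₂ := by
  induction l₁ generalizing x with
  | nil => rfl
  | cons p t ih => exact ih _

/-- Over a finite field every scalar is a square or a difference of two squares, so every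
symplectic transvection is a composition of quandle operations. -/
theorem exists_symOpSeq_eq_transvection {F : Type*} [Field F] [Finite F] {M : Type*}
    [AddCommGroup M] [Module F M] (B : M →ₗ[F] M →ₗ[F] F) (hAlt : ∀ x : M, B x x = 0)
    (x w : M) (a : F) : ∃ l, symOpSeq B x l = x + (a * B x w) • w := by
  by_cases h2 : (2 : F) = 0
  · have : CharP F 2 := CharTwo.of_one_ne_zero_of_two_eq_zero one_ne_zero h2
    obtain ⟨c, rfl⟩ := FiniteField.isSquare_of_char_two (ringChar.eq F 2) a
    refine ⟨[(c • w, true)], ?_⟩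
    simp only [symOpSeq, symOp, if_true, map_smul, smul_eq_mul]
    module
  · refine ⟨[(((a + 1) / 2) • w, true), (((a - 1) / 2) • w, false)], ?_⟩
    simp only [symOpSeq, symOp, symOpInv, if_true, Bool.false_eq_true, if_false, map_smul,
      map_add, LinearMap.add_apply, LinearMap.smul_apply, smul_eq_mul, hAlt, mul_zero, add_zero,
      smul_smul]
    rw [add_sub_assoc, ← sub_smul]
    congr 2
    field_simp
    ring

theorem exists_symOpSeq_eq_of_apply_ne_zero {F : Type*} [Field F] [Finite F] {M : Type*}
    [AddCommGroup M] [Module F M] (B : M →ₗ[F] M →ₗ[F] F) (hAlt : ∀ x : M, B x x = 0)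
    {x y : M} (h : B x y ≠ 0) : ∃ l, symOpSeq B x l = y := by
  obtain ⟨l, hl⟩ := exists_symOpSeq_eq_transvection B hAlt x (y - x) (B x y)⁻¹
  refine ⟨l, ?_⟩
  rw [hl, map_sub, hAlt, sub_zero, inv_mul_cancel₀ h, one_smul, add_sub_cancel]

theorem LinearMap.exists_apply_ne_zero_and_apply_ne_zero {R M N : Type*} [Semiring R]
    [AddCommMonoid M] [AddCommMonoid N] [Module R M] [Module R N] {f g : M →ₗ[R] N}
    (hf : ∃ u, f u ≠ 0) (hg : ∃ u, g u ≠ 0) : ∃ u, f u ≠ 0 ∧ g u ≠ 0 := by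
  obtain ⟨u, hu⟩ := hf
  obtain ⟨v, hv⟩ := hg
  by_cases hgu : g u = 0
  · by_cases hfv : f v = 0
    · exact ⟨u + v, by simpa [hfv] using hu, by simpa [hgu] using hv⟩
    · exact ⟨v, hfv, hv⟩
  · exact ⟨u, hu, hgu⟩

/-- over a finite field, with `B` a nondegenerate alternating form on
a finite-dimensional space, the symplectic quandle `M \ {0}` is connected: any two
nonzero elements are related by a finite sequence of `▷^{±1}` operations. -/
theorem symplectic_quandle_connected
    (F : Type*) [Field F] [Fintype F]
    (M : Type*) [AddCommGroup M] [Module F M] [FiniteDimensional F M]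
    (B : M →ₗ[F] M →ₗ[F] F)
    (hAlt : ∀ x : M, B x x = 0)
    (hNondeg : ∀ x : M, (∀ y : M, B x y = 0) → x = 0)
    (x y : M) (hx : x ≠ 0) (hy : y ≠ 0) :
    ∃ (n : ℕ) (z : Fin n → M) (ε : Fin n → Bool),
      symOpSeq B x (List.ofFn fun i => (z i, ε i)) = y := by
  have hex : ∀ v : M, v ≠ 0 → ∃ u, B v u ≠ 0 := fun v hv => by
    contrapose! hv
    exact hNondeg v hv
  obtain ⟨u, hxu, hyu⟩ :=
    LinearMap.exists_apply_ne_zero_and_apply_ne_zero (hex x hx) (hex y hy)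
  have huy : B u y ≠ 0 := by
    rw [← LinearMap.IsAlt.neg (B := B) hAlt]
    exact neg_ne_zero.mpr hyu
  obtain ⟨l₁, h₁⟩ := exists_symOpSeq_eq_of_apply_ne_zero B hAlt hxu
  obtain ⟨l₂, h₂⟩ := exists_symOpSeq_eq_of_apply_ne_zero B hAlt huy
  refine ⟨(l₁ ++ l₂).length, fun i => ((l₁ ++ l₂).get i).1, fun i => ((l₁ ++ l₂).get i).2, ?_⟩
  simp only [Prod.mk.eta, List.ofFn_get]
  rw [symOpSeq_append, h₁, h₂]
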